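/- Let X be a Hilbert space and S a densely defined closed Fredholm operator in X. Let P and Q be the orthogonal projections of X onto ker(S) and onto Ran(S)^⊥ respectively, and let S† be a bounded operator on X satisfying S† S u = u − P u for all u ∈ Dom(S), S S† = I − Q on X, P S† = 0 and S† Q = 0 (a generalized inverse of S). Suppose S^p, L, R are bounded operators on X with Ran(S^p) ⊆ Dom(S), S^p S u = u + L u for all u ∈ Dom(S), and S S^p = I + R on X (a parametrix of S). Then S† = S^p(I − Q) + L S† R − L(I − P)S^p as operators on X. -/

import Mathlib

/-- relation between a generalized inverse `S†` and a parametrix `S^p` of a densely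
defined closed Fredholm operator `S` in a Hilbert space:
`S† = S^p (I - Q) + L S† R - L (I - P) S^p`. -/
theorem statement3 {X : Type*} [NormedAddCommGroup X] [InnerProductSpace ℂ X] [CompleteSpace X]
    (S : X →ₗ.[ℂ] X) (hdense : Dense (S.domain : Set X))
    (hclosed : IsClosed (S.graph : Set (X × X)))
    (hran : IsClosed (LinearMap.range S.toFun : Set X))
    (hker : FiniteDimensional ℂ (LinearMap.ker S.toFun))
    (hcoker : FiniteDimensional ℂ (X ⧸ LinearMap.range S.toFun))
    (Kt Ran : Submodule ℂ X)
    (hKt : Kt = (LinearMap.ker S.toFun).map S.domain.subtype)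
    (hRan : Ran = LinearMap.range S.toFun)
    -- P, Q: the orthogonal projections onto ker S and (Ran S)ᗮ
    (P Q : X →L[ℂ] X)
    (hP1 : ∀ x : X, P x ∈ Kt) (hP2 : ∀ x : X, x - P x ∈ Ktᗮ)
    (hQ1 : ∀ x : X, Q x ∈ Ranᗮ) (hQ2 : ∀ x : X, x - Q x ∈ Ran)
    -- S†: a generalized inverse of S
    (Sd : X →L[ℂ] X)
    (hSd1 : ∀ u : S.domain, Sd (S u) = (u : X) - P u)
    (hSd2 : ∀ f : X, (Sd f, f - Q f) ∈ S.graph)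
    (hSd3 : ∀ f : X, P (Sd f) = 0)
    (hSd4 : ∀ f : X, Sd (Q f) = 0)
    -- S^p, L, R: a parametrix of S
    (Sp L R : X →L[ℂ] X)
    (hSpdom : ∀ f : X, Sp f ∈ S.domain)
    (hSpS : ∀ u : S.domain, Sp (S u) = (u : X) + L u)
    (hSSp : ∀ f : X, (Sp f, f + R f) ∈ S.graph) :
    ∀ f : X, Sd f = Sp (f - Q f) + L (Sd (R f)) - L (Sp f - P (Sp f)) := by
  intro f
  obtain ⟨u, hu, hSu⟩ := (LinearPMap.mem_graph_iff S).1 (hSd2 f)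
  obtain ⟨v, hv, hSv⟩ := (LinearPMap.mem_graph_iff S).1 (hSSp f)
  have h₁ := hSpS u
  have h₂ := hSd1 v
  simp only at hu hv hSu hSv
  rw [hSu, hu] at h₁
  rw [hSv, hv, map_add] at h₂
  rw [h₁, ← h₂, map_add]
  abel
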